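/- In an egoistic election game with a monotone WP function, let s be a profile, let i be a party, and let s'_i be a candidate index of party i with u_i(x_{i,s'_i}) ≥ u_i(x_{i,s_i}) and u(x_{i,s'_i}) ≥ u(x_{i,s_i}). If moreover either p_{i,(s'_i,s_{-i})} > p_{i,s}, or both u_i(x_{i,s'_i}) > u_i(x_{i,s_i}) and p_{i,(s'_i,s_{-i})} > 0, then r_i(s'_i, s_{-i}) > r_i(s); in particular, the profile s is not a pure-strategy Nash equilibrium. -/

import Mathlib

/-- Moving mass onto the index `i` where `v` is largest does not decrease a weighted sum of `v`. -/
theorem sum_mul_le_sum_mul_of_shift {ι : Type*} [Fintype ι] {p q v : ι → ℝ} {i : ι}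
    (hsum : ∑ j, p j = ∑ j, q j) (hqp : ∀ j, j ≠ i → q j ≤ p j) (hv : ∀ j, j ≠ i → v j < v i) :
    ∑ j, p j * v j ≤ ∑ j, q j * v j := by
  have hnonneg : 0 ≤ ∑ j, (q j - p j) * (v j - v i) := by
    refine Finset.sum_nonneg fun j _ => ?_
    by_cases hj : j = i
    · simp [hj]
    · exact mul_nonneg_of_nonpos_of_nonpos (sub_nonpos.2 (hqp j hj)) (sub_nonpos.2 (hv j hj).le)
  simp only [sub_mul, mul_sub, Finset.sum_sub_distrib, ← Finset.sum_mul] at hnonneg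
  rw [hsum] at hnonneg
  linarith

/-- Moving a positive amount of mass onto the index `i` where `v` is strictly largest increases a
weighted sum of `v`. -/
theorem sum_mul_lt_sum_mul_of_shift {ι : Type*} [Fintype ι] {p q v : ι → ℝ} {i : ι}
    (hsum : ∑ j, p j = ∑ j, q j) (hqp : ∀ j, j ≠ i → q j ≤ p j) (hv : ∀ j, j ≠ i → v j < v i)
    (hi : p i < q i) :
    ∑ j, p j * v j < ∑ j, q j * v j := by
  obtain ⟨k, hk⟩ : ∃ k, q k < p k := by
    by_contra! h
    exact hsum.not_lt (Finset.sum_lt_sum (fun j _ => h j) ⟨i, Finset.mem_univ i, hi⟩)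
  have hki : k ≠ i := by
    rintro rfl
    exact lt_asymm hi hk
  have hpos : 0 < ∑ j, (q j - p j) * (v j - v i) := by
    refine Finset.sum_pos' (fun j _ => ?_) ⟨k, Finset.mem_univ k,
      mul_pos_of_neg_of_neg (sub_neg.2 hk) (sub_neg.2 (hv k hki))⟩
    by_cases hj : j = i
    · simp [hj]
    · exact mul_nonneg_of_nonpos_of_nonpos (sub_nonpos.2 (hqp j hj)) (sub_nonpos.2 (hv j hj).le)
  simp only [sub_mul, mul_sub, Finset.sum_sub_distrib, ← Finset.sum_mul] at hpos
  rw [hsum] at hpos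
  linarith

/-- In an egoistic election game with a monotone WP function, if at a profile `σ`
party `i` has an alternative candidate `s'` with `u_i(x_{i,s'}) ≥ u_i(x_{i,σ i})` and
`u(x_{i,s'}) ≥ u(x_{i,σ i})`, and moreover either the switch strictly increases
party `i`'s winning probability, or `s'` brings strictly more utility to party `i`'s
supporters and wins with positive probability after the switch (i.e. `s'` surpasses
`σ i`), then the deviation strictly increases party `i`'s payoff; in particular `σ`
is not a pure-strategy Nash equilibrium. -/
theorem surpassed_profile_not_PSNE
    (m : ℕ) (hm : 2 ≤ m)
    (n : Fin m → ℕ) (hn : ∀ i, 2 ≤ n i)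
    (U : (i : Fin m) → Fin (n i) → Fin m → ℝ)
    (hUpos : ∀ (i : Fin m) (s : Fin (n i)) (j : Fin m), 0 ≤ U i s j)
    (hsorted : ∀ (i : Fin m) (s t : Fin (n i)), s ≤ t → U i t i ≤ U i s i)
    (hego : ∀ i j : Fin m, i ≠ j → ∀ (si : Fin (n i)) (sj : Fin (n j)), U j sj i < U i si i)
    (u : (i : Fin m) → Fin (n i) → ℝ)
    (hu : ∀ (i : Fin m) (s : Fin (n i)), u i s = ∑ j, U i s j)
    (p : ((i : Fin m) → Fin (n i)) → Fin m → ℝ)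
    (hpnn : ∀ (σ : (i : Fin m) → Fin (n i)) (i : Fin m), 0 ≤ p σ i)
    (hpsum : ∀ σ : (i : Fin m) → Fin (n i), ∑ i, p σ i = 1)
    (hmono₁ : ∀ (σ : (i : Fin m) → Fin (n i)) (i : Fin m) (s' : Fin (n i)),
      u i (σ i) ≤ u i s' →
        p σ i ≤ p (Function.update σ i s') i ∧
        ∀ j, j ≠ i → p (Function.update σ i s') j ≤ p σ j)
    (hmono₂ : ∀ (σ : (i : Fin m) → Fin (n i)) (i j : Fin m),
      u j (σ j) < u i (σ i) → p σ j ≤ p σ i)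
    (r : Fin m → ((i : Fin m) → Fin (n i)) → ℝ)
    (hr : ∀ (i : Fin m) (σ : (i : Fin m) → Fin (n i)),
      r i σ = ∑ j, p σ j * U j (σ j) i)
    (σ : (i : Fin m) → Fin (n i)) (i : Fin m) (s' : Fin (n i))
    (hU' : U i (σ i) i ≤ U i s' i)
    (hu' : u i (σ i) ≤ u i s')
    (hstrict : p σ i < p (Function.update σ i s') i ∨
      (U i (σ i) i < U i s' i ∧ 0 < p (Function.update σ i s') i)) :
    r i σ < r i (Function.update σ i s') ∧
    ¬ (∀ (k : Fin m) (t : Fin (n k)), r k (Function.update σ k t) ≤ r k σ) := by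
  have hgain : r i σ < r i (Function.update σ i s') := by
    obtain ⟨-, hothers⟩ := hmono₁ σ i s' hu'
    have hsum : ∑ j, p σ j = ∑ j, p (Function.update σ i s') j := by rw [hpsum, hpsum]
    have hlt : ∀ j, j ≠ i → U j (σ j) i < U i (σ i) i := fun j hj => hego i j hj.symm _ _
    have hle : ∀ j, U j (σ j) i ≤ U j (Function.update σ i s' j) i := by
      intro j
      by_cases hj : j = i
      · subst hj
        simpa using hU'
      · rw [Function.update_of_ne hj]
    have hterm : ∀ j ∈ Finset.univ, p (Function.update σ i s') j * U j (σ j) i ≤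
        p (Function.update σ i s') j * U j (Function.update σ i s' j) i :=
      fun j _ => mul_le_mul_of_nonneg_left (hle j) (hpnn _ j)
    rw [hr, hr]
    rcases hstrict with hp | ⟨hU, hp⟩
    · exact (sum_mul_lt_sum_mul_of_shift (v := fun j => U j (σ j) i) hsum hothers hlt hp).trans_le
        (Finset.sum_le_sum hterm)
    · refine (sum_mul_le_sum_mul_of_shift (v := fun j => U j (σ j) i) hsum hothers hlt).trans_lt
        (Finset.sum_lt_sum hterm ⟨i, Finset.mem_univ i, ?_⟩)
      rw [Function.update_self]
      exact mul_lt_mul_of_pos_left hU hp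
  exact ⟨hgain, fun h => (h i s').not_gt hgain⟩
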